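/- Let S be a 0-left cancellative semigroup with zero admitting least common multiples. Then every open ultracharacter φ on the semilattice E(S) of constructible sets satisfies φ = φ_{σ_φ}, where σ_φ = {s ∈ S : φ(E_s) = 1} is an open string; in particular, every open ultracharacter is of the form φ_σ for some open string σ. -/

import Mathlib

/-- A semigroup with zero is `0`-left cancellative if `s*t = s*r ≠ 0` implies `t = r`. -/
def ZeroLeftCancellative (S : Type*) [SemigroupWithZero S] : Prop :=
  ∀ s t r : S, s * t = s * r → s * t ≠ 0 → t = r

/-- `s` divides `t` when `t ∈ {s} ∪ sS`. -/
def Divides {S : Type*} [Mul S] (s t : S) : Prop := t = s ∨ ∃ u, s * u = t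

/-- `r` is a least common multiple of `s` and `t` when `sS ∩ tS = rS` and both `s` and `t`
divide `r`. -/
def IsLCM {S : Type*} [Mul S] (s t r : S) : Prop :=
  ({x | ∃ u, x = s * u} ∩ {x | ∃ u, x = t * u} = {x | ∃ u, x = r * u}) ∧
    Divides s r ∧ Divides t r

/-- The regular representation: `theta s` is the graph of the partial bijection
`θ_s : F_s → E_s`, `x ↦ s*x`, of `S' = S \ {0}`. -/
def theta {S : Type*} [SemigroupWithZero S] (s : S) : S → S → Prop :=
  fun x y => x ≠ 0 ∧ s * x ≠ 0 ∧ y = s * x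

/-- The identity partial bijection on a subset `X`, viewed as a relation. -/
def idOn {α : Type*} (X : Set α) : α → α → Prop := fun x y => x = y ∧ x ∈ X

/-- The inverse subsemigroup of the symmetric inverse semigroup generated by the
partial bijections `π s`, where relations model partial bijections by their graphs:
`Relation.Comp r₁ r₂` applies `r₁` first, and `flip r` is the inverse of `r`. -/
inductive InHull {S α : Type*} (π : S → α → α → Prop) : (α → α → Prop) → Prop
  | base (s : S) : InHull π (π s)
  | inv {r : α → α → Prop} : InHull π r → InHull π (flip r)
  | comp {r₁ r₂ : α → α → Prop} : InHull π r₁ → InHull π r₂ →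
      InHull π (Relation.Comp r₁ r₂)

/-- `X ⊆ S'` is constructible when `id_X` belongs to the idempotent semilattice `E(S)`
of the inverse hull `H(S)` of the regular representation. -/
def Constructible (S : Type*) [SemigroupWithZero S] (X : Set S) : Prop :=
  InHull (theta (S := S)) (idOn X)

/-- A string in `S`: a nonempty subset not containing `0`, closed under divisors,
and directed with respect to divisibility. -/
def IsString {S : Type*} [SemigroupWithZero S] (σ : Set S) : Prop :=
  σ.Nonempty ∧ (0 : S) ∉ σ ∧
  (∀ s t : S, Divides s t → t ∈ σ → s ∈ σ) ∧
  (∀ s₁ ∈ σ, ∀ s₂ ∈ σ, ∃ s ∈ σ, Divides s₁ s ∧ Divides s₂ s)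

/-- The character `φ_σ` of the semilattice of constructible sets associated with a
string `σ`:  `φ_σ(X) = 1` iff `σ ∈ ε(X)`, where the representation `ε` sends a
constructible set `X` to the set of strings asymptotically contained in `X`
(i.e. those strings in which `X ∩ σ` is cofinal for the divisibility order). -/
noncomputable def charOfString {S : Type*} [SemigroupWithZero S] (σ : Set S) :
    Set S → Bool :=
  fun X => @decide (∀ s ∈ σ, ∃ t, t ∈ X ∩ σ ∧ Divides s t) (Classical.propDecidable _)

/-- A character of the semilattice `E(S)` of constructible sets: a nonzero,
zero-preserving, multiplicative `{0,1}`-valued map on constructible sets. -/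
def IsCharE (S : Type*) [SemigroupWithZero S] (φ : Set S → Bool) : Prop :=
  (∃ X : Set S, Constructible S X ∧ φ X = true) ∧
  φ (∅ : Set S) = false ∧
  ∀ X Y : Set S, Constructible S X → Constructible S Y →
    φ (X ∩ Y) = (φ X && φ Y)

/-- The string `σ_φ = {s : φ(E_s) = 1}` associated with a character `φ` of the
semilattice of constructible sets, where `E_s = sS \ {0}`. -/
def sigmaOf {S : Type*} [SemigroupWithZero S] (φ : Set S → Bool) : Set S :=
  {s : S | φ {y | y ≠ 0 ∧ ∃ x : S, y = s * x} = true}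

section

variable {S : Type*} [SemigroupWithZero S]

/-- A left multiplier of `S` is the identity or left multiplication by an element of `S`, that
is, left multiplication by an element of `S` with an external identity adjoined. -/
def IsLeftMul (f : S → S) : Prop := f = id ∨ ∃ s : S, f = fun x => s * x

namespace IsLeftMul

variable {f g : S → S}

lemma map_mul (hf : IsLeftMul f) (x y : S) : f (x * y) = f x * y := by
  rcases hf with rfl | ⟨s, rfl⟩
  · rfl
  · exact (mul_assoc s x y).symm

lemma comp (hf : IsLeftMul f) (hg : IsLeftMul g) : IsLeftMul (f ∘ g) := by
  rcases hf with rfl | ⟨s, rfl⟩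
  · exact hg
  · rcases hg with rfl | ⟨t, rfl⟩
    · exact Or.inr ⟨s, rfl⟩
    · exact Or.inr ⟨s * t, funext fun x => (mul_assoc s t x).symm⟩

lemma cancel (hlc : ZeroLeftCancellative S) (hf : IsLeftMul f) {x y : S}
    (h : f x = f y) (h0 : f x ≠ 0) : x = y := by
  rcases hf with rfl | ⟨s, rfl⟩
  · exact h
  · exact hlc s x y h h0

end IsLeftMul

lemma Divides.exists_leftMul {s t : S} (h : Divides s t) :
    ∃ a : S → S, IsLeftMul a ∧ ∀ x, s * a x = t * x := by
  rcases h with rfl | ⟨u, rfl⟩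
  · exact ⟨id, Or.inl rfl, fun _ => rfl⟩
  · exact ⟨fun x => u * x, Or.inr ⟨u, rfl⟩, fun x => (mul_assoc s u x).symm⟩

/-- Least common multiples in `S` provide pullbacks of left multipliers. -/
lemma IsLeftMul.exists_pullback (hlc : ZeroLeftCancellative S)
    (hlcm : ∀ s t : S, ∃ r : S, IsLCM s t r) {f g : S → S}
    (hf : IsLeftMul f) (hg : IsLeftMul g) :
    ∃ a b : S → S, IsLeftMul a ∧ IsLeftMul b ∧ (∀ x, f (a x) = g (b x)) ∧
      ∀ x y, f x = g y → f x ≠ 0 → ∃ c, x = a c ∧ y = b c := by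
  rcases hf with rfl | ⟨s, rfl⟩
  · exact ⟨g, id, hg, Or.inl rfl, fun _ => rfl, fun x y h _ => ⟨y, h, rfl⟩⟩
  rcases hg with rfl | ⟨t, rfl⟩
  · exact ⟨id, fun x => s * x, Or.inl rfl, Or.inr ⟨s, rfl⟩, fun _ => rfl,
      fun x y h _ => ⟨x, rfl, h.symm⟩⟩
  obtain ⟨r, hr, hsr, htr⟩ := hlcm s t
  obtain ⟨a, ha, hsa⟩ := hsr.exists_leftMul
  obtain ⟨b, hb, htb⟩ := htr.exists_leftMul
  refine ⟨a, b, ha, hb, fun x => (hsa x).trans (htb x).symm, fun x y h h0 => ?_⟩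
  have hmem : s * x ∈ {z | ∃ u, z = r * u} := hr ▸ ⟨⟨x, rfl⟩, ⟨y, h⟩⟩
  obtain ⟨c, hc⟩ := hmem
  exact ⟨c, hlc s x _ (hc.trans (hsa c).symm) h0,
    hlc t y _ (h.symm.trans (hc.trans (htb c).symm)) (ne_of_eq_of_ne h.symm h0)⟩

/-- Normal form of the elements of the inverse hull: each is of the form `v x ↦ u x` for left
multipliers `u`, `v` and `x` ranging over a set closed under left factors. -/
lemma InHull.exists_normalForm (hlc : ZeroLeftCancellative S)
    (hlcm : ∀ s t : S, ∃ r : S, IsLCM s t r) {r : S → S → Prop}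
    (hr : InHull (theta (S := S)) r) :
    ∃ (v u : S → S) (H : Set S), IsLeftMul v ∧ IsLeftMul u ∧
      (∀ x z, x * z ∈ H → x ∈ H) ∧ (∀ x ∈ H, v x ≠ 0 ∧ u x ≠ 0) ∧
      ∀ y z, r y z ↔ ∃ x ∈ H, y = v x ∧ z = u x := by
  induction hr with
  | base s =>
    refine ⟨id, fun x => s * x, {x | x ≠ 0 ∧ s * x ≠ 0}, Or.inl rfl, Or.inr ⟨s, rfl⟩,
      ?_, fun x hx => hx, fun y z => ?_⟩
    · rintro x z ⟨h, h'⟩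
      exact ⟨left_ne_zero_of_mul h, left_ne_zero_of_mul (b := z) (by rwa [mul_assoc])⟩
    · constructor
      · rintro ⟨h, h', rfl⟩
        exact ⟨y, ⟨h, h'⟩, rfl, rfl⟩
      · rintro ⟨x, ⟨h, h'⟩, rfl, rfl⟩
        exact ⟨h, h', rfl⟩
  | inv _ ih =>
    obtain ⟨v, u, H, hv, hu, hH, h0, h⟩ := ih
    exact ⟨u, v, H, hu, hv, hH, fun x hx => (h0 x hx).symm,
      fun y z => (h z y).trans (by simp only [and_comm])⟩
  | comp _ _ ih₁ ih₂ =>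
    obtain ⟨v, u, H, hv, hu, hH, h0, h⟩ := ih₁
    obtain ⟨v', u', H', hv', hu', hH', h0', h'⟩ := ih₂
    obtain ⟨a, b, ha, hb, hab, hpull⟩ := hu.exists_pullback hlc hlcm hv'
    refine ⟨v ∘ a, u' ∘ b, {c | a c ∈ H ∧ b c ∈ H'}, hv.comp ha, hu'.comp hb, ?_,
      fun x hx => ⟨(h0 _ hx.1).1, (h0' _ hx.2).2⟩, fun y z => ?_⟩
    · rintro x z ⟨hx, hx'⟩
      exact ⟨hH _ z (ha.map_mul x z ▸ hx), hH' _ z (hb.map_mul x z ▸ hx')⟩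
    · constructor
      · rintro ⟨w, hyw, hwz⟩
        obtain ⟨x, hx, rfl, rfl⟩ := (h _ _).1 hyw
        obtain ⟨x', hx', hxx', rfl⟩ := (h' _ _).1 hwz
        obtain ⟨c, rfl, rfl⟩ := hpull x x' hxx' (h0 x hx).2
        exact ⟨c, ⟨hx, hx'⟩, rfl, rfl⟩
      · rintro ⟨c, ⟨hc, hc'⟩, rfl, rfl⟩
        exact ⟨u (a c), (h _ _).2 ⟨_, hc, rfl, rfl⟩, (h' _ _).2 ⟨_, hc', hab c, rfl⟩⟩

namespace Constructible

variable {X : Set S}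

lemma exists_leftMul (hlc : ZeroLeftCancellative S)
    (hlcm : ∀ s t : S, ∃ r : S, IsLCM s t r) (hX : Constructible S X) :
    (0 : S) ∉ X ∧ ∃ u : S → S, IsLeftMul u ∧ X ⊆ Set.range u ∧
      ∀ m z, u m * z ∈ X → u m ∈ X := by
  obtain ⟨v, u, H, hv, hu, hH, h0, h⟩ := InHull.exists_normalForm hlc hlcm hX
  have hmem : ∀ x ∈ X, ∃ m ∈ H, x = u m := fun x hx =>
    let ⟨m, hm, _, hxm⟩ := (h x x).1 ⟨rfl, hx⟩
    ⟨m, hm, hxm⟩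
  refine ⟨fun h0X => ?_, u, hu, fun x hx => ?_, fun m z hmz => ?_⟩
  · obtain ⟨m, hm, h0m⟩ := hmem 0 h0X
    exact (h0 m hm).2 h0m.symm
  · obtain ⟨m, _, rfl⟩ := hmem x hx
    exact ⟨m, rfl⟩
  · obtain ⟨n, hn, hmn⟩ := hmem _ hmz
    rw [← hu.map_mul] at hmn
    obtain rfl : n = m * z := hu.cancel hlc hmn.symm (h0 n hn).2
    obtain ⟨hvu, hvX⟩ := (h _ _).2 ⟨m, hH m z hn, rfl, rfl⟩
    exact hvu ▸ hvX

lemma mem_of_divides (hlc : ZeroLeftCancellative S)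
    (hlcm : ∀ s t : S, ∃ r : S, IsLCM s t r) (hX : Constructible S X) {x y z : S}
    (hx : x ∈ X) (hz : z ∈ X) (hxy : Divides x y) (hyz : Divides y z) : y ∈ X := by
  obtain ⟨-, u, hu, hXu, hmem⟩ := hX.exists_leftMul hlc hlcm
  rcases hxy with rfl | ⟨p, rfl⟩
  · exact hx
  rcases hyz with rfl | ⟨q, rfl⟩
  · exact hz
  obtain ⟨m, rfl⟩ := hXu hx
  rw [← hu.map_mul] at hz ⊢
  exact hmem _ q hz

lemma principal (s : S) : Constructible S {y | y ≠ 0 ∧ ∃ x : S, y = s * x} := by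
  have h : idOn {y | y ≠ 0 ∧ ∃ x : S, y = s * x} =
      Relation.Comp (flip (theta s)) (theta s) := by
    funext y z
    apply propext
    constructor
    · rintro ⟨rfl, h, x, rfl⟩
      exact ⟨x, ⟨right_ne_zero_of_mul h, h, rfl⟩, right_ne_zero_of_mul h, h, rfl⟩
    · rintro ⟨x, ⟨_, h, rfl⟩, _, _, rfl⟩
      exact ⟨rfl, h, x, rfl⟩
  rw [Constructible, h]
  exact InHull.comp (InHull.inv (InHull.base s)) (InHull.base s)

end Constructible

lemma Divides.trans {r s t : S} (h : Divides r s) (h' : Divides s t) : Divides r t := by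
  rcases h with rfl | ⟨u, rfl⟩
  · exact h'
  · rcases h' with rfl | ⟨v, rfl⟩
    · exact Or.inr ⟨u, rfl⟩
    · exact Or.inr ⟨u * v, (mul_assoc r u v).symm⟩

lemma charOfString_eq_true {σ X : Set S} :
    charOfString σ X = true ↔ ∀ s ∈ σ, ∃ t, t ∈ X ∩ σ ∧ Divides s t := by
  simp [charOfString]

lemma charOfString_inter (hlc : ZeroLeftCancellative S)
    (hlcm : ∀ s t : S, ∃ r : S, IsLCM s t r) (σ : Set S) {X Y : Set S}
    (hX : Constructible S X) :
    charOfString σ (X ∩ Y) = (charOfString σ X && charOfString σ Y) := by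
  rw [Bool.eq_iff_iff, Bool.and_eq_true]
  simp only [charOfString_eq_true]
  constructor
  · intro h
    constructor <;> intro s hs <;> obtain ⟨t, ⟨⟨hx, hy⟩, ht⟩, hst⟩ := h s hs
    · exact ⟨t, ⟨hx, ht⟩, hst⟩
    · exact ⟨t, ⟨hy, ht⟩, hst⟩
  · rintro ⟨hσX, hσY⟩ s hs
    obtain ⟨x, ⟨hx, hxσ⟩, hsx⟩ := hσX s hs
    obtain ⟨y, ⟨hy, hyσ⟩, hxy⟩ := hσY x hxσ
    obtain ⟨z, ⟨hz, -⟩, hyz⟩ := hσX y hyσ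
    exact ⟨y, ⟨⟨hX.mem_of_divides hlc hlcm hx hz hxy hyz, hy⟩, hyσ⟩, hsx.trans hxy⟩

/-- A character with open string is dominated by the character of its string. -/
lemma charOfString_sigmaOf_of_eq_true (hlc : ZeroLeftCancellative S)
    (hlcm : ∀ s t : S, ∃ r : S, IsLCM s t r) {φ : Set S → Bool} (hchar : IsCharE S φ)
    (hstr : IsString (sigmaOf φ)) (hopen : ∀ s ∈ sigmaOf φ, ∃ p : S, s * p ∈ sigmaOf φ)
    {X : Set S} (hX : Constructible S X) (hφX : φ X = true) :
    charOfString (sigmaOf φ) X = true := by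
  obtain ⟨-, hempty, hinter⟩ := hchar
  obtain ⟨h0, u, hu, hXu, hmem⟩ := hX.exists_leftMul hlc hlcm
  have hmeet : ∀ s ∈ sigmaOf φ, ∃ z, s * z ∈ X := by
    intro s hs
    have h : φ (X ∩ {y | y ≠ 0 ∧ ∃ x : S, y = s * x}) = true := by
      rw [hinter _ _ hX (Constructible.principal s), hφX, Bool.true_and]
      exact hs
    have hne : (X ∩ {y | y ≠ 0 ∧ ∃ x : S, y = s * x}).Nonempty := by
      by_contra hne
      rw [Set.not_nonempty_iff_eq_empty.1 hne, hempty] at h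
      exact Bool.false_ne_true h
    obtain ⟨_, hx, _, z, rfl⟩ := hne
    exact ⟨z, hx⟩
  rw [charOfString_eq_true]
  intro s hs
  rcases hu with rfl | ⟨a, rfl⟩
  · obtain ⟨z, hz⟩ := hmeet s hs
    exact ⟨s, ⟨hmem s z hz, hs⟩, Or.inl rfl⟩
  · have ha : a ∈ sigmaOf φ := by
      have hXa : X ∩ {y | y ≠ 0 ∧ ∃ x : S, y = a * x} = X := by
        refine Set.inter_eq_left.2 fun x hx => ⟨fun hx0 => h0 (hx0 ▸ hx), ?_⟩
        obtain ⟨m, rfl⟩ := hXu hx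
        exact ⟨m, rfl⟩
      have h := hinter _ _ hX (Constructible.principal a)
      rw [hXa, hφX, Bool.true_and] at h
      exact h.symm
    obtain ⟨v, hv, hsv, hav⟩ := hstr.2.2.2 s hs a ha
    obtain ⟨p, hp⟩ := hopen v hv
    obtain ⟨b, -, hb⟩ := hav.exists_leftMul
    obtain ⟨z, hz⟩ := hmeet _ hp
    refine ⟨v * p, ⟨?_, hp⟩, hsv.trans (Or.inr ⟨p, rfl⟩)⟩
    rw [← hb] at hz ⊢
    exact hmem _ z hz

end

/-- If `S` is a `0`-left cancellative semigroup admitting least common multiples, then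
every open ultracharacter `φ` of the semilattice `E(S)` of constructible sets
satisfies `φ = φ_{σ_φ}`; in particular it is of the form `φ_σ` for an open string `σ`. -/
theorem strings.openUltraIsPhiSigma {S : Type*} [SemigroupWithZero S]
    (hlc : ZeroLeftCancellative S)
    (hlcm : ∀ s t : S, ∃ r : S, IsLCM s t r)
    (φ : Set S → Bool) (hchar : IsCharE S φ)
    (hultra : ∀ ψ : Set S → Bool, IsCharE S ψ →
      (∀ X : Set S, Constructible S X → φ X = true → ψ X = true) →
      ∀ X : Set S, Constructible S X → ψ X = φ X)
    (hstr : IsString (sigmaOf φ))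
    (hopen : ∀ s ∈ sigmaOf φ, ∃ p : S, s * p ∈ sigmaOf φ) :
    (∀ X : Set S, Constructible S X → φ X = charOfString (sigmaOf φ) X) ∧
    ∃ σ : Set S, IsString σ ∧ (∀ s ∈ σ, ∃ p : S, s * p ∈ σ) ∧
      ∀ X : Set S, Constructible S X → φ X = charOfString σ X := by
  have hle : ∀ X : Set S, Constructible S X → φ X = true →
      charOfString (sigmaOf φ) X = true := fun X hX hφX =>
    charOfString_sigmaOf_of_eq_true hlc hlcm hchar hstr hopen hX hφX
  have hcharσ : IsCharE S (charOfString (sigmaOf φ)) := by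
    refine ⟨?_, ?_, fun X Y hX _ => charOfString_inter hlc hlcm _ hX⟩
    · obtain ⟨X, hX, hφX⟩ := hchar.1
      exact ⟨X, hX, hle X hX hφX⟩
    · rw [Bool.eq_false_iff, ne_eq, charOfString_eq_true]
      intro h
      obtain ⟨s, hs⟩ := hstr.1
      obtain ⟨t, ⟨ht, -⟩, -⟩ := h s hs
      exact ht
  have heq : ∀ X : Set S, Constructible S X → φ X = charOfString (sigmaOf φ) X :=
    fun X hX => (hultra _ hcharσ hle X hX).symm
  exact ⟨heq, sigmaOf φ, hstr, hopen, heq⟩
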